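/- Let p be an odd prime and ℤ_p the cyclic group of order p. Fix a ∈ ℤ_p, a ≠ 0. There is a labeling of ℤ_p \ {0, a, −a} by symbols {x,y,z} with exactly α symbols x, β symbols y, α symbols z for any nonnegative integers α, β with 2α + β = p−3, such that: no vertex labeled x has vertex v+a labeled y, no vertex labeled z has v−a labeled y, no vertex labeled z has v−2a labeled x, the vertex −2a is not labeled x, and the vertex 2a is not labeled z. -/

import Mathlib

/-- A three-element set of labels. -/
inductive Lab | x | y | z
deriving DecidableEq

/-- The elements of `ZMod p` other than the spine labels `0`, `a`, `-a`. -/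
def offSpine (p : ℕ) [NeZero p] (a : ZMod p) : Finset (ZMod p) :=
  Finset.univ \ {0, a, -a}

/-- The representative `n < p` with `v = n * a`, for `a ≠ 0`. -/
def multIdx {p : ℕ} (a v : ZMod p) : ℕ := (v * a⁻¹).val

/-- The word `(xz)^α yyy…`, with its letters indexed from `2`. -/
def wordLab (α n : ℕ) : Lab :=
  if n < 2 * α + 2 then (if n % 2 = 0 then Lab.x else Lab.z) else Lab.y

theorem wordLab_eq_x {α n : ℕ} : wordLab α n = Lab.x ↔ n < 2 * α + 2 ∧ n % 2 = 0 := by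
  unfold wordLab; split_ifs <;> simp_all

theorem wordLab_eq_y {α n : ℕ} : wordLab α n = Lab.y ↔ 2 * α + 2 ≤ n := by
  unfold wordLab; split_ifs <;> simp_all

theorem wordLab_eq_z {α n : ℕ} : wordLab α n = Lab.z ↔ n < 2 * α + 2 ∧ n % 2 = 1 := by
  unfold wordLab; split_ifs <;> simp_all

section
variable {p : ℕ} [Fact p.Prime] {a : ZMod p}

theorem multIdx_lt (a v : ZMod p) : multIdx a v < p := ZMod.val_lt _

theorem multIdx_mul (ha : a ≠ 0) (v : ZMod p) : (multIdx a v : ZMod p) * a = v := by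
  rw [multIdx, ZMod.natCast_zmod_val, inv_mul_cancel_right₀ ha]

theorem multIdx_natCast_mul (ha : a ≠ 0) {n : ℕ} (hn : n < p) :
    multIdx a ((n : ZMod p) * a) = n := by
  rw [multIdx, mul_inv_cancel_right₀ ha, ZMod.val_natCast_of_lt hn]

theorem multIdx_eq (ha : a ≠ 0) {n : ℕ} (hn : n < p) {v : ZMod p} (hv : v = (n : ZMod p) * a) :
    multIdx a v = n := by
  rw [hv, multIdx_natCast_mul ha hn]

theorem multIdx_eq_iff (ha : a ≠ 0) {n : ℕ} (hn : n < p) {v : ZMod p} :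
    multIdx a v = n ↔ v = (n : ZMod p) * a :=
  ⟨fun h => by rw [← h, multIdx_mul ha], multIdx_eq ha hn⟩

theorem natCast_pred_mul (a : ZMod p) : ((p - 1 : ℕ) : ZMod p) * a = -a := by
  rw [Nat.cast_sub (Fact.out : p.Prime).one_le]; simp

theorem mem_offSpine_iff [NeZero p] (ha : a ≠ 0) {v : ZMod p} :
    v ∈ offSpine p a ↔ 2 ≤ multIdx a v ∧ multIdx a v + 2 ≤ p := by
  have hp := (Fact.out : p.Prime).two_le
  have h0 := multIdx_eq_iff ha (n := 0) (v := v) (by omega)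
  have h1 := multIdx_eq_iff ha (n := 1) (v := v) (by omega)
  have h2 := multIdx_eq_iff ha (n := p - 1) (v := v) (by omega)
  rw [natCast_pred_mul] at h2
  simp only [Nat.cast_zero, zero_mul, Nat.cast_one, one_mul] at h0 h1
  have hlt := multIdx_lt a v
  simp only [offSpine, Finset.mem_sdiff, Finset.mem_univ, true_and, Finset.mem_insert,
    Finset.mem_singleton, ← h0, ← h1, ← h2]
  omega

/-- A subset of `offSpine p a` whose indices are exactly the values of an injective sequence on
`range m` has `m` elements. -/
theorem card_filter_offSpine [NeZero p] (ha : a ≠ 0) (P : ZMod p → Prop) [DecidablePred P]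
    (m : ℕ) (f : ℕ → ℕ) (hf : Function.Injective f)
    (h : ∀ v, v ∈ offSpine p a ∧ P v ↔ ∃ i < m, f i = multIdx a v) (hlt : ∀ i < m, f i < p) :
    ((offSpine p a).filter P).card = m := by
  have himage : (offSpine p a).filter P =
      (Finset.range m).image fun i => (f i : ZMod p) * a := by
    ext v
    simp only [Finset.mem_filter, h, Finset.mem_image, Finset.mem_range]
    refine exists_congr fun i => and_congr_right fun hi => ?_
    rw [eq_comm, multIdx_eq_iff ha (hlt i hi), eq_comm]
  rw [himage, Finset.card_image_of_injOn, Finset.card_range]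
  intro i hi j hj hij
  have hi := hlt i (by simpa using hi)
  have hj := hlt j (by simpa using hj)
  apply hf
  rw [← multIdx_natCast_mul ha hi, ← multIdx_natCast_mul ha hj]
  exact congrArg _ hij

theorem multIdx_add_self (ha : a ≠ 0) {v : ZMod p} (h : multIdx a v + 1 < p) :
    multIdx a (v + a) = multIdx a v + 1 := by
  apply multIdx_eq ha h
  rw [Nat.cast_add, add_mul, multIdx_mul ha]; simp

theorem multIdx_sub_natCast_mul (ha : a ≠ 0) {v : ZMod p} {k : ℕ} (h : k ≤ multIdx a v) :
    multIdx a (v - k * a) = multIdx a v - k := by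
  apply multIdx_eq ha ((Nat.sub_le _ _).trans_lt (multIdx_lt a v))
  rw [Nat.cast_sub h, sub_mul, multIdx_mul ha]

end

theorem stmt9 (p : ℕ) [NeZero p] (hp : p.Prime) (hodd : Odd p)
    (a : ZMod p) (ha : a ≠ 0) (α β : ℕ) (hαβ : 2 * α + β = p - 3) :
    ∃ ℓ : ZMod p → Lab,
      ((offSpine p a).filter fun v => ℓ v = Lab.x).card = α ∧
      ((offSpine p a).filter fun v => ℓ v = Lab.y).card = β ∧
      ((offSpine p a).filter fun v => ℓ v = Lab.z).card = α ∧
      (∀ v ∈ offSpine p a, v + a ∈ offSpine p a →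
        ¬(ℓ v = Lab.x ∧ ℓ (v + a) = Lab.y)) ∧
      (∀ v ∈ offSpine p a, v - a ∈ offSpine p a →
        ¬(ℓ v = Lab.z ∧ ℓ (v - a) = Lab.y)) ∧
      (∀ v ∈ offSpine p a, v - 2 * a ∈ offSpine p a →
        ¬(ℓ v = Lab.z ∧ ℓ (v - 2 * a) = Lab.x)) ∧
      (-(2 * a) ∈ offSpine p a → ℓ (-(2 * a)) ≠ Lab.x) ∧
      (2 * a ∈ offSpine p a → ℓ (2 * a) ≠ Lab.z) := by
  have := Fact.mk hp
  have h3 : 3 ≤ p := by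
    have := hp.two_le
    obtain ⟨k, hk⟩ := hodd
    omega
  refine ⟨fun v => wordLab α (multIdx a v), ?_, ?_, ?_, ?_, ?_, ?_, ?_, ?_⟩
  · refine card_filter_offSpine ha _ α (fun i => 2 * i + 2) (fun i j h => by grind) ?_
      (fun i hi => by omega)
    intro v
    rw [mem_offSpine_iff ha, wordLab_eq_x]
    exact ⟨fun h => ⟨multIdx a v / 2 - 1, by omega, by omega⟩, fun ⟨i, hi, h⟩ => by omega⟩
  · refine card_filter_offSpine ha _ β (fun i => i + (2 * α + 2)) (fun i j h => by grind) ?_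
      (fun i hi => by omega)
    intro v
    rw [mem_offSpine_iff ha, wordLab_eq_y]
    exact ⟨fun h => ⟨multIdx a v - (2 * α + 2), by omega, by omega⟩, fun ⟨i, hi, h⟩ => by omega⟩
  · refine card_filter_offSpine ha _ α (fun i => 2 * i + 3) (fun i j h => by grind) ?_
      (fun i hi => by omega)
    intro v
    rw [mem_offSpine_iff ha, wordLab_eq_z]
    exact ⟨fun h => ⟨multIdx a v / 2 - 1, by omega, by omega⟩, fun ⟨i, hi, h⟩ => by omega⟩
  · intro v hv _
    rw [mem_offSpine_iff ha] at hv
    rw [wordLab_eq_x, wordLab_eq_y, multIdx_add_self ha (by omega)]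
    omega
  · intro v hv _
    rw [mem_offSpine_iff ha] at hv
    have h := multIdx_sub_natCast_mul ha (v := v) (k := 1) (by omega)
    rw [Nat.cast_one, one_mul] at h
    rw [wordLab_eq_z, wordLab_eq_y, h]
    omega
  · intro v hv _
    rw [mem_offSpine_iff ha] at hv
    have h := multIdx_sub_natCast_mul ha (v := v) (k := 2) (by omega)
    rw [Nat.cast_ofNat] at h
    rw [wordLab_eq_z, wordLab_eq_x, h]
    omega
  · intro _
    have h : multIdx a (-(2 * a)) = p - 2 := by
      apply multIdx_eq ha (by omega)
      rw [Nat.cast_sub hp.two_le]; simp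
    rw [Ne, wordLab_eq_x, h]
    obtain ⟨k, hk⟩ := hodd
    omega
  · intro _
    have h : multIdx a (2 * a) = 2 := multIdx_eq ha (by omega) (by simp)
    rw [Ne, wordLab_eq_z, h]
    omega
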